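/- Suppose g_0(X;Y) = 0 and ε ↦ g_ε(X;Y) is linear on [0, I(X;Y)], i.e., g_ε(X;Y) = ε·H(Y)/I(X;Y) for 0 ≤ ε ≤ I(X;Y). Then for every y ∈ 𝒴, H(Y)/I(X;Y) = (−log P_Y(y)) / D(P_{X|Y}(·|y) ‖ P_X). -/

import Mathlib

open scoped BigOperators

noncomputable section

namespace RatePrivacy

variable {α β γ : Type*}

/-- `p` is a probability mass function on a finite alphabet. -/
def IsPMF [Fintype α] (p : α → ℝ) : Prop := (∀ a, 0 ≤ p a) ∧ ∑ a, p a = 1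

/-- Shannon entropy (in bits) of the distribution `p`. -/
def ent [Fintype α] (p : α → ℝ) : ℝ := ∑ a, -(p a * Real.logb 2 (p a))

/-- First marginal of a joint distribution. -/
def margA [Fintype α] [Fintype β] (p : α × β → ℝ) : α → ℝ := fun a => ∑ b, p (a, b)

/-- Second marginal of a joint distribution. -/
def margB [Fintype α] [Fintype β] (p : α × β → ℝ) : β → ℝ := fun b => ∑ a, p (a, b)

/-- Mutual information (in bits) of a joint distribution `p`:
`I(A;B) = H(A) + H(B) - H(A,B)`. -/
def mi [Fintype α] [Fintype β] (p : α × β → ℝ) : ℝ :=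
  ent (margA p) + ent (margB p) - ent p

/-- `q` is a (row-stochastic) channel. -/
def IsChannel [Fintype γ] (q : β → γ → ℝ) : Prop :=
  (∀ y z, 0 ≤ q y z) ∧ ∀ y, ∑ z, q y z = 1

/-- Joint distribution of `(X, Z)` when `Z` is obtained from `Y` through the channel `q`
(so that `X — Y — Z` is a Markov chain). -/
def jointXZ [Fintype α] [Fintype β] [Fintype γ] (p : α × β → ℝ) (q : β → γ → ℝ) :
    α × γ → ℝ := fun xz => ∑ y, p (xz.1, y) * q y xz.2

/-- Joint distribution of `(Y, Z)` when `Z` is obtained from `Y` through the channel `q`. -/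
def jointYZ [Fintype α] [Fintype β] [Fintype γ] (p : α × β → ℝ) (q : β → γ → ℝ) :
    β × γ → ℝ := fun yz => margB p yz.1 * q yz.1 yz.2

/-- Achievable rates `I(Y;Z)` over all privacy filters `Z` (on finite alphabets, wlog `Fin n`)
with `X — Y — Z` Markov and `I(X;Z) ≤ ε`. -/
def gSet [Fintype α] [Fintype β] (p : α × β → ℝ) (ε : ℝ) : Set ℝ :=
  { r | ∃ (n : ℕ) (q : β → Fin n → ℝ), IsChannel q ∧
        mi (jointXZ p q) ≤ ε ∧ r = mi (jointYZ p q) }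

/-- The rate-privacy function `g_ε(X;Y)` (privacy measured by mutual information). -/
def g [Fintype α] [Fintype β] (p : α × β → ℝ) (ε : ℝ) : ℝ := sSup (gSet p ε)

/-- Values `E[f(A) g(B)]` over all zero-mean unit-variance `f, g`, used to define
the Hirschfeld–Gebelein–Rényi maximal correlation. -/
def corrSet [Fintype α] [Fintype β] (p : α × β → ℝ) : Set ℝ :=
  { r | ∃ (f : α → ℝ) (g : β → ℝ),
      (∑ a, margA p a * f a = 0) ∧ (∑ b, margB p b * g b = 0) ∧
      (∑ a, margA p a * (f a) ^ 2 = 1) ∧ (∑ b, margB p b * (g b) ^ 2 = 1) ∧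
      r = ∑ x : α × β, p x * (f x.1 * g x.2) }

/-- Maximal correlation `ρ_m(A;B)` (equal to `0` when the constraint set is empty,
since `sSup ∅ = 0` in `ℝ`). -/
def rhoM [Fintype α] [Fintype β] (p : α × β → ℝ) : ℝ := sSup (corrSet p)

/-- Achievable rates with maximal-correlation privacy constraint `ρ_m²(X;Z) ≤ ε`. -/
def ghSet [Fintype α] [Fintype β] (p : α × β → ℝ) (ε : ℝ) : Set ℝ :=
  { r | ∃ (n : ℕ) (q : β → Fin n → ℝ), IsChannel q ∧
        (rhoM (jointXZ p q)) ^ 2 ≤ ε ∧ r = mi (jointYZ p q) }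

/-- The rate-privacy function `ĝ_ε(X;Y)` (privacy measured by squared maximal correlation). -/
def gh [Fintype α] [Fintype β] (p : α × β → ℝ) (ε : ℝ) : ℝ := sSup (ghSet p ε)

/-- The Kullback–Leibler divergence (in bits) `D(P_{X|Y}(·|y) ‖ P_X)`. -/
def Dxy [Fintype α] [Fintype β] (p : α × β → ℝ) (y : β) : ℝ :=
  ∑ x, (p (x, y) / margB p y) * Real.logb 2 ((p (x, y) / margB p y) / margA p x)

open Filter Topology

section Divergence

/-- Gibbs' inequality for finite measures of equal mass. -/
theorem sum_mul_logb_div_nonneg {α : Type*} [Fintype α] {r s : α → ℝ}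
    (hr : ∀ a, 0 ≤ r a) (hs : ∀ a, 0 ≤ s a) (hrs : ∀ a, s a = 0 → r a = 0)
    (hsum : ∑ a, r a = ∑ a, s a) :
    0 ≤ ∑ a, r a * Real.logb 2 (r a / s a) := by
  have hlog : 0 < Real.log 2 := Real.log_pos one_lt_two
  have key : ∀ a, (r a - s a) / Real.log 2 ≤ r a * Real.logb 2 (r a / s a) := by
    intro a
    rcases (hr a).eq_or_lt with h | h
    · rw [← h, zero_mul]
      exact div_nonpos_of_nonpos_of_nonneg (by linarith [hs a]) hlog.le
    · have h' : 0 < s a := (hs a).lt_of_ne fun h0 => h.ne' (hrs a h0.symm)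
      have h1 := Real.one_sub_inv_le_log_of_pos (div_pos h h')
      have h2 : r a - s a = r a * (1 - (r a / s a)⁻¹) := by field_simp
      rw [Real.logb, ← mul_div_assoc, h2]
      gcongr
  calc (0 : ℝ) = ∑ a, (r a - s a) / Real.log 2 := by
        rw [← Finset.sum_div, Finset.sum_sub_distrib, hsum, sub_self, zero_div]
    _ ≤ _ := Finset.sum_le_sum fun a _ => key a

end Divergence

section MutualInformation

variable {α β : Type*} [Fintype α] [Fintype β] {p : α × β → ℝ}

theorem le_margA (hp : ∀ x, 0 ≤ p x) (a : α) (b : β) : p (a, b) ≤ margA p a :=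
  Finset.single_le_sum (f := fun b => p (a, b)) (fun _ _ => hp _) (Finset.mem_univ b)

theorem le_margB (hp : ∀ x, 0 ≤ p x) (a : α) (b : β) : p (a, b) ≤ margB p b :=
  Finset.single_le_sum (f := fun a => p (a, b)) (fun _ _ => hp _) (Finset.mem_univ a)

theorem sum_margA : ∑ a, margA p a = ∑ x, p x := (Fintype.sum_prod_type p).symm

theorem sum_margB : ∑ b, margB p b = ∑ x, p x := (Fintype.sum_prod_type_right p).symm

/-- Mutual information as the divergence from the product of the marginals. -/
theorem mi_eq_sum (hp : ∀ x, 0 ≤ p x) :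
    mi p = ∑ b, ∑ a, p (a, b) * Real.logb 2 (p (a, b) / (margA p a * margB p b)) := by
  have hA : ent (margA p) = ∑ b, ∑ a, -(p (a, b) * Real.logb 2 (margA p a)) := by
    rw [Finset.sum_comm]
    refine Finset.sum_congr rfl fun a _ => ?_
    rw [Finset.sum_neg_distrib, ← Finset.sum_mul]
    rfl
  have hB : ent (margB p) = ∑ b, ∑ a, -(p (a, b) * Real.logb 2 (margB p b)) := by
    refine Finset.sum_congr rfl fun b _ => ?_
    rw [Finset.sum_neg_distrib, ← Finset.sum_mul]
    rfl
  rw [mi, hA, hB, ent, Fintype.sum_prod_type_right]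
  simp_rw [← Finset.sum_add_distrib, ← Finset.sum_sub_distrib]
  refine Finset.sum_congr rfl fun b _ => Finset.sum_congr rfl fun a _ => ?_
  rcases (hp (a, b)).eq_or_lt with h | h
  · simp [← h]
  · have h1 := h.trans_le (le_margA hp a b)
    have h2 := h.trans_le (le_margB hp a b)
    rw [Real.logb_div h.ne' (mul_pos h1 h2).ne', Real.logb_mul h1.ne' h2.ne']
    ring

/-- A marginal has at most the entropy of the joint distribution. -/
theorem ent_margB_le (hp : ∀ x, 0 ≤ p x) : ent (margB p) ≤ ent p := by
  rw [ent, ent, Fintype.sum_prod_type_right]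
  refine Finset.sum_le_sum fun b _ => ?_
  rw [Finset.sum_neg_distrib, neg_le_neg_iff]
  nth_rewrite 1 [margB]
  rw [Finset.sum_mul]
  refine Finset.sum_le_sum fun a _ => ?_
  rcases (hp (a, b)).eq_or_lt with h | h
  · simp [← h]
  · exact mul_le_mul_of_nonneg_left
      (Real.logb_le_logb_of_le one_lt_two h (le_margB hp a b)) h.le

/-- Mutual information as an average of divergences. -/
theorem mi_eq_sum_Dxy (hp : ∀ x, 0 ≤ p x) (hY : ∀ b, 0 < margB p b) :
    mi p = ∑ b, margB p b * Dxy p b := by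
  rw [mi_eq_sum hp]
  refine Finset.sum_congr rfl fun b _ => ?_
  rw [Dxy, Finset.mul_sum]
  refine Finset.sum_congr rfl fun a _ => ?_
  rw [← mul_assoc, mul_div_cancel₀ _ (hY b).ne', div_div, mul_comm (margB p b)]

theorem Dxy_nonneg (hp : IsPMF p) {b : β} (hb : 0 < margB p b) : 0 ≤ Dxy p b := by
  refine sum_mul_logb_div_nonneg (fun a => div_nonneg (hp.1 _) hb.le)
    (fun a => Finset.sum_nonneg fun _ _ => hp.1 _) (fun a h => ?_) ?_
  · have := le_margA hp.1 a b
    rw [le_antisymm (this.trans h.le) (hp.1 _), zero_div]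
  · rw [← Finset.sum_div, sum_margA, hp.2]
    exact div_self hb.ne'

end MutualInformation

section Alarm

/-- The binary channel signalling the letter `y` with probability `δ`, and otherwise silent. -/
def alarm {β : Type*} (y : β) (δ : ℝ) : β → Fin 2 → ℝ :=
  open Classical in fun b => ![if b = y then δ else 0, 1 - if b = y then δ else 0]

theorem isChannel_alarm {β : Type*} {y : β} {δ : ℝ} (h0 : 0 ≤ δ) (h1 : δ ≤ 1) :
    IsChannel (alarm y δ) := by
  constructor
  · intro b z
    fin_cases z <;> by_cases h : b = y <;> simp [alarm, h, h0, h1]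
  · intro b
    simp [alarm, Fin.sum_univ_two]

end Alarm

section RatePrivacyFunction

variable {α β γ : Type*} [Fintype α] [Fintype β] [Fintype γ] {p : α × β → ℝ} {q : β → γ → ℝ}

theorem margA_jointXZ (hq : IsChannel q) : margA (jointXZ p q) = margA p := by
  funext a
  simp_rw [margA, jointXZ]
  rw [Finset.sum_comm]
  simp_rw [← Finset.mul_sum, hq.2, mul_one]

theorem margA_jointYZ (hq : IsChannel q) : margA (jointYZ p q) = margB p := by
  funext b
  simp_rw [margA, jointYZ, ← Finset.mul_sum, hq.2, mul_one]

theorem margB_jointXZ (c : γ) : margB (jointXZ p q) c = ∑ b, margB p b * q b c := by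
  simp_rw [margB, jointXZ, Finset.sum_mul]
  exact Finset.sum_comm

theorem jointXZ_nonneg (hp : ∀ x, 0 ≤ p x) (hq : IsChannel q) (x : α × γ) :
    0 ≤ jointXZ p q x :=
  Finset.sum_nonneg fun _ _ => mul_nonneg (hp _) (hq.1 _ _)

theorem jointYZ_nonneg (hp : ∀ x, 0 ≤ p x) (hq : IsChannel q) (x : β × γ) :
    0 ≤ jointYZ p q x :=
  mul_nonneg (Finset.sum_nonneg fun _ _ => hp _) (hq.1 _ _)

theorem bddAbove_gSet (hp : ∀ x, 0 ≤ p x) (ε : ℝ) : BddAbove (gSet p ε) := by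
  refine ⟨ent (margB p), ?_⟩
  rintro _ ⟨n, q, hq, -, rfl⟩
  rw [mi, margA_jointYZ hq]
  linarith [ent_margB_le (jointYZ_nonneg hp hq)]

variable {y : β} {δ : ℝ}

theorem sum_mul_alarm_zero (f : β → ℝ) : ∑ b, f b * alarm y δ b 0 = δ * f y := by
  classical simp [alarm, mul_comm]

theorem sum_mul_alarm_one (f : β → ℝ) : ∑ b, f b * alarm y δ b 1 = ∑ b, f b - δ * f y := by
  classical simp [alarm, mul_sub, mul_comm]

theorem le_mi_jointYZ_alarm (hp : IsPMF p) (hy : 0 < margB p y) (h0 : 0 < δ) (h1 : δ ≤ 1 / 2) :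
    δ * margB p y * -Real.logb 2 (margB p y) ≤ mi (jointYZ p (alarm y δ)) := by
  have hq : IsChannel (alarm y δ) := isChannel_alarm h0.le (by linarith)
  have hJ := jointYZ_nonneg hp.1 hq
  have hB0 : margB (jointYZ p (alarm y δ)) 0 = δ * margB p y := sum_mul_alarm_zero (margB p)
  have hBn (c : Fin 2) : 0 ≤ margB (jointYZ p (alarm y δ)) c := Finset.sum_nonneg fun _ _ => hJ _
  rw [mi_eq_sum hJ, margA_jointYZ hq, Fin.sum_univ_two]
  have hsilent : 0 ≤ ∑ b, jointYZ p (alarm y δ) (b, 1) * Real.logb 2 (jointYZ p (alarm y δ) (b, 1) /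
      (margB p b * margB (jointYZ p (alarm y δ)) 1)) := by
    refine sum_mul_logb_div_nonneg (fun b => hJ _)
      (fun b => mul_nonneg (Finset.sum_nonneg fun _ _ => hp.1 _) (hBn 1)) (fun b h => ?_) ?_
    · rcases mul_eq_zero.1 h with h | h
      · rw [jointYZ, h, zero_mul]
      · exact le_antisymm ((le_margB hJ b 1).trans h.le) (hJ _)
    · rw [← Finset.sum_mul, sum_margB, hp.2, one_mul]
      rfl
  have hsignal : ∑ b, jointYZ p (alarm y δ) (b, 0) * Real.logb 2 (jointYZ p (alarm y δ) (b, 0) /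
      (margB p b * margB (jointYZ p (alarm y δ)) 0)) =
      δ * margB p y * -Real.logb 2 (margB p y) := by
    rw [Finset.sum_eq_single y, hB0]
    · have : jointYZ p (alarm y δ) (y, 0) = δ * margB p y := by simp [jointYZ, alarm, mul_comm]
      rw [this, ← Real.logb_inv]
      congr 2
      field_simp
    · intro b _ hb
      simp [jointYZ, alarm, hb]
    · simp
  linarith

theorem mi_jointXZ_alarm_le (hp : IsPMF p) (hy : 0 < margB p y) (h0 : 0 < δ) (h1 : δ ≤ 1 / 2) :
    mi (jointXZ p (alarm y δ)) ≤ δ * margB p y * Dxy p y + 2 / Real.log 2 * δ ^ 2 := by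
  have hlog : 0 < Real.log 2 := Real.log_pos one_lt_two
  have hq : IsChannel (alarm y δ) := isChannel_alarm h0.le (by linarith)
  have hJ := jointXZ_nonneg hp.1 hq
  have hJ0 (a : α) : jointXZ p (alarm y δ) (a, 0) = δ * p (a, y) :=
    sum_mul_alarm_zero fun b => p (a, b)
  have hJ1 (a : α) : jointXZ p (alarm y δ) (a, 1) = margA p a - δ * p (a, y) :=
    sum_mul_alarm_one fun b => p (a, b)
  have hB0 : margB (jointXZ p (alarm y δ)) 0 = δ * margB p y := by
    rw [margB_jointXZ, sum_mul_alarm_zero]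
  have hB1 : margB (jointXZ p (alarm y δ)) 1 = 1 - δ * margB p y := by
    rw [margB_jointXZ, sum_mul_alarm_one, sum_margB, hp.2]
  have hy1 : margB p y ≤ 1 := by
    rw [← hp.2, ← sum_margB]
    exact Finset.single_le_sum (f := margB p)
      (fun b _ => Finset.sum_nonneg fun _ _ => hp.1 _) (Finset.mem_univ y)
  rw [mi_eq_sum hJ, margA_jointXZ hq, Fin.sum_univ_two, hB0, hB1]
  simp_rw [hJ0, hJ1]
  set t := margB p y with ht
  have hb : 1 / 2 ≤ 1 - δ * t := by nlinarith
  have hb0 : 0 < 1 - δ * t := by linarith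
  refine add_le_add (le_of_eq ?_) ?_
  · rw [Dxy, Finset.mul_sum]
    refine Finset.sum_congr rfl fun a _ => ?_
    have harg : δ * p (a, y) / (margA p a * (δ * t)) = p (a, y) / t / margA p a := by
      rw [mul_left_comm, mul_div_mul_left _ _ h0.ne', div_div, mul_comm t]
    rw [← ht, harg]
    field_simp
  · have key : ∀ a, (margA p a - δ * p (a, y)) *
        Real.logb 2 ((margA p a - δ * p (a, y)) / (margA p a * (1 - δ * t))) ≤
        ((margA p a - 2 * δ * p (a, y) + δ ^ 2 * p (a, y)) / (1 - δ * t) -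
          (margA p a - δ * p (a, y))) / Real.log 2 := by
      intro a
      have hv := hp.1 (a, y)
      have hvu := le_margA hp.1 a y
      set u := margA p a
      set v := p (a, y)
      rcases (hv.trans hvu).eq_or_lt with hu | hu
      · have : v = 0 := by linarith
        simp [this, ← hu]
      · have hw : 0 < u - δ * v := by nlinarith
        have hl := Real.log_le_sub_one_of_pos (div_pos hw (mul_pos hu hb0))
        rw [Real.logb, ← mul_div_assoc]
        gcongr
        refine (mul_le_mul_of_nonneg_left hl hw.le).trans ?_
        have hsq : (u - δ * v) ^ 2 / u ≤ u - 2 * δ * v + δ ^ 2 * v := by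
          rw [div_le_iff₀ hu]
          nlinarith [mul_nonneg (sq_nonneg δ) (mul_nonneg hv (sub_nonneg.2 hvu))]
        calc (u - δ * v) * ((u - δ * v) / (u * (1 - δ * t)) - 1)
            = (u - δ * v) ^ 2 / u / (1 - δ * t) - (u - δ * v) := by
              field_simp
          _ ≤ _ := by gcongr
    refine (Finset.sum_le_sum fun a _ => key a).trans ?_
    have hpt : ∑ a, p (a, y) = t := rfl
    rw [← Finset.sum_div, Finset.sum_sub_distrib, ← Finset.sum_div, Finset.sum_add_distrib,
      Finset.sum_sub_distrib, Finset.sum_sub_distrib, ← Finset.mul_sum, ← Finset.mul_sum,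
      ← Finset.mul_sum, hpt, sum_margA, hp.2, div_mul_eq_mul_div]
    gcongr
    rw [sub_le_iff_le_add, div_le_iff₀ hb0]
    nlinarith [mul_nonneg (sq_nonneg δ) hy.le, mul_nonneg (sq_nonneg δ) (sub_nonneg.2 hy1),
      mul_le_mul_of_nonneg_left hb (sq_nonneg δ), sq_nonneg (δ * t)]

/-- If `ε ↦ g_ε` is linear with slope `H(Y)/I(X;Y)`, no letter is revealed more efficiently
than that slope. -/
theorem neg_logb_margB_le (hp : IsPMF p) (hy : 0 < margB p y) (hI : 0 < mi p)
    (hD : 0 ≤ Dxy p y)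
    (hlin : ∀ ε : ℝ, 0 ≤ ε → ε ≤ mi p → g p ε = ε * ent (margB p) / mi p) :
    -Real.logb 2 (margB p y) ≤ ent (margB p) / mi p * Dxy p y := by
  have hlog : 0 < Real.log 2 := Real.log_pos one_lt_two
  refine le_of_mul_le_mul_left (a := margB p y) ?_ hy
  have hlim : Tendsto (fun δ : ℝ => (margB p y * Dxy p y + 2 / Real.log 2 * δ) *
      ent (margB p) / mi p) (𝓝[>] 0)
      (𝓝 ((margB p y * Dxy p y + 2 / Real.log 2 * 0) * ent (margB p) / mi p)) :=
    (Continuous.tendsto (by fun_prop) 0).mono_left nhdsWithin_le_nhds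
  have hsmall : ∀ᶠ δ : ℝ in 𝓝[>] 0,
      δ * margB p y * Dxy p y + 2 / Real.log 2 * δ ^ 2 < mi p := by
    refine (Tendsto.mono_left (Continuous.tendsto ?_ 0) nhdsWithin_le_nhds).eventually_lt_const
      (v := 0 * margB p y * Dxy p y + 2 / Real.log 2 * 0 ^ 2) ?_
    · fun_prop
    · simpa using hI
  have hhalf : ∀ᶠ δ : ℝ in 𝓝[>] 0, δ < 1 / 2 :=
    nhdsWithin_le_nhds (Iio_mem_nhds (by norm_num))
  have hbound := ge_of_tendsto (b := margB p y * -Real.logb 2 (margB p y)) hlim (by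
    filter_upwards [hsmall, hhalf, self_mem_nhdsWithin] with δ h1 h2 (h3 : 0 < δ)
    refine le_of_mul_le_mul_left (a := δ) ?_ h3
    rw [← mul_assoc]
    refine (le_mi_jointYZ_alarm hp hy h3 h2.le).trans ?_
    have hle := le_csSup (bddAbove_gSet hp.1 _) ⟨2, alarm y δ, isChannel_alarm h3.le (by linarith),
      mi_jointXZ_alarm_le hp hy h3 h2.le, rfl⟩
    refine hle.trans (le_of_eq ?_)
    rw [← g, hlin _ (by positivity) h1.le]
    ring)
  refine hbound.trans (le_of_eq ?_)
  ring

end RatePrivacyFunction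

/-- If `g_0(X;Y) = 0` and `ε ↦ g_ε(X;Y)` is linear on `[0, I(X;Y)]`
(i.e. `g_ε = ε·H(Y)/I(X;Y)` there), then for every `y`,
`H(Y)/I(X;Y) = (−log P_Y(y)) / D(P_{X|Y}(·|y)‖P_X)`. -/
theorem stmt12 {𝓧 𝓨 : Type*} [Fintype 𝓧] [Fintype 𝓨]
    (p : 𝓧 × 𝓨 → ℝ) (hp : IsPMF p)
    (hYpos : ∀ y, 0 < margB p y)
    (hdep : ¬ ∀ x y, p (x, y) = margA p x * margB p y)
    (hg0 : g p 0 = 0)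
    (hlin : ∀ ε : ℝ, 0 ≤ ε → ε ≤ mi p → g p ε = ε * ent (margB p) / mi p) :
    ∀ y : 𝓨, ent (margB p) / mi p = (-(Real.logb 2 (margB p y))) / Dxy p y := by
  have hD (y : 𝓨) : 0 ≤ Dxy p y := Dxy_nonneg hp (hYpos y)
  have hmi := mi_eq_sum_Dxy hp.1 hYpos
  have hterm : ∀ y ∈ Finset.univ, 0 ≤ margB p y * Dxy p y :=
    fun y _ => mul_nonneg (hYpos y).le (hD y)
  intro y
  rcases (hmi ▸ Finset.sum_nonneg hterm : 0 ≤ mi p).eq_or_lt with hI | hI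
  · have h := (Finset.sum_eq_zero_iff_of_nonneg hterm).1 (hmi.symm.trans hI.symm) y
      (Finset.mem_univ y)
    rw [← hI, (mul_eq_zero.1 h).resolve_left (hYpos y).ne', div_zero, div_zero]
  set c := ent (margB p) / mi p with hc
  have hgap : ∀ y ∈ Finset.univ, 0 ≤ margB p y * (c * Dxy p y + Real.logb 2 (margB p y)) :=
    fun y _ => mul_nonneg (hYpos y).le
      (by linarith [neg_logb_margB_le hp (hYpos y) hI (hD y) hlin])
  have hsum : ∑ y, margB p y * (c * Dxy p y + Real.logb 2 (margB p y)) = 0 := by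
    have h1 : c * ∑ y, margB p y * Dxy p y = ent (margB p) := by
      rw [← hmi, hc, div_mul_cancel₀ _ hI.ne']
    rw [Finset.mul_sum, ent, ← sub_eq_zero, ← Finset.sum_sub_distrib] at h1
    rw [← h1]
    exact Finset.sum_congr rfl fun y _ => by ring
  have heq := (mul_eq_zero.1 ((Finset.sum_eq_zero_iff_of_nonneg hgap).1 hsum y
    (Finset.mem_univ y))).resolve_left (hYpos y).ne'
  by_cases hDy : Dxy p y = 0
  · have hlog : Real.logb 2 (margB p y) = 0 := by simpa [hDy] using heq
    have hone : margB p y = 1 := Real.eq_one_of_pos_of_logb_eq_zero one_lt_two (hYpos y) hlog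
    have hent : ent (margB p) = 0 := by
      refine Finset.sum_eq_zero fun y' _ => ?_
      rcases eq_or_ne y' y with rfl | hne
      · rw [hlog, mul_zero, neg_zero]
      · have h := Finset.add_le_sum (f := margB p) (fun b _ => (hYpos b).le)
          (Finset.mem_univ y') (Finset.mem_univ y) hne
        rw [sum_margB, hp.2, hone] at h
        linarith [hYpos y']
    rw [hc, hent, hDy, zero_div, div_zero]
  · rw [eq_div_iff hDy]
    linarith

end RatePrivacy
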